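/- There exists a constant c > 0 such that for every fixed integer r ≥ 1, with probability tending to 1 as n → ∞ over G ← G(n,1/2), the matrix M_G is positive semidefinite for every positive integer k ≤ 2^{−cr}·(√n/log n)^{1/r}. -/

import Mathlib

open Finset Filter

/-- `deg_G(I)`: the number of sets `S ⊆ [n]` with `I ⊆ S`, `|S| = 2r`, and `S` a clique
of `G`. -/
noncomputable def degG {n : ℕ} (G : SimpleGraph (Fin n)) (r : ℕ) (I : Finset (Fin n)) : ℕ :=
  Nat.card {S : Finset (Fin n) // I ⊆ S ∧ S.card = 2 * r ∧ G.IsClique (S : Set (Fin n))}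

/-- The matrix `M_G`, with rows and columns indexed by the `r`-element subsets of `[n]`,
defined by `M_G(I,J) = deg_G(I∪J) · C(k,|I∪J|)/C(2r,|I∪J|)`. -/
noncomputable def MG {n : ℕ} (G : SimpleGraph (Fin n)) (r k : ℕ) :
    Matrix {I : Finset (Fin n) // I.card = r} {I : Finset (Fin n) // I.card = r} ℝ :=
  fun I J => (degG G r (I.1 ∪ J.1) : ℝ) * (Nat.choose k (I.1 ∪ J.1).card : ℝ)
      / (Nat.choose (2 * r) (I.1 ∪ J.1).card : ℝ)

theorem sum_exp_linear_le {Ω ι : Type*} [Fintype Ω] [DecidableEq ι] (T : Finset ι)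
    (Y : ι → Ω → ℝ) (σ : ι → Equiv.Perm Ω) (hle : ∀ i ∈ T, ∀ ω, |Y i ω| ≤ 1)
    (hneg : ∀ i ∈ T, ∀ ω, Y i (σ i ω) = -Y i ω)
    (hfix : ∀ i ∈ T, ∀ j ∈ T, j ≠ i → ∀ ω, Y j (σ i ω) = Y j ω) (a : ι → ℝ) :
    ∑ ω, Real.exp (∑ i ∈ T, a i * Y i ω) ≤
      Fintype.card Ω * Real.exp ((∑ i ∈ T, a i ^ 2) / 2) := by
  induction T using Finset.induction_on with
  | empty => simp
  | insert i T hi ih =>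
    have ih' := ih (fun j hj => hle j (mem_insert_of_mem hj))
      (fun j hj => hneg j (mem_insert_of_mem hj))
      (fun j hj l hl => hfix j (mem_insert_of_mem hj) l (mem_insert_of_mem hl))
    have hfix' : ∀ ω, ∑ j ∈ T, a j * Y j (σ i ω) = ∑ j ∈ T, a j * Y j ω := fun ω =>
      sum_congr rfl fun j hj => by
        rw [hfix i (mem_insert_self _ _) j (mem_insert_of_mem hj) (fun h => hi (h ▸ hj))]
    have hflip : ∑ ω, Real.exp (∑ j ∈ insert i T, a j * Y j ω) =
        ∑ ω, Real.exp (-(a i * Y i ω)) * Real.exp (∑ j ∈ T, a j * Y j ω) := by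
      rw [← Equiv.sum_comp (σ i)]
      refine sum_congr rfl fun ω _ => ?_
      rw [sum_insert hi, hfix', hneg i (mem_insert_self _ _), Real.exp_add, mul_neg]
    have hsum : 2 * ∑ ω, Real.exp (∑ j ∈ insert i T, a j * Y j ω) =
        ∑ ω, 2 * Real.cosh (a i * Y i ω) * Real.exp (∑ j ∈ T, a j * Y j ω) := by
      rw [two_mul]
      nth_rewrite 2 [hflip]
      rw [← sum_add_distrib]
      refine sum_congr rfl fun ω _ => ?_
      rw [sum_insert hi, Real.exp_add, Real.cosh_eq]
      ring
    have hcosh : ∀ ω, Real.cosh (a i * Y i ω) ≤ Real.exp (a i ^ 2 / 2) := fun ω => by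
      refine (Real.cosh_le_exp_half_sq _).trans (Real.exp_le_exp.2 ?_)
      have h1 : (Y i ω) ^ 2 ≤ 1 := by
        have := hle i (mem_insert_self _ _) ω
        exact (sq_le_one_iff_abs_le_one _).2 this
      have h2 := sq_nonneg (a i)
      rw [mul_pow]
      nlinarith
    have hle2 : ∑ ω, 2 * Real.cosh (a i * Y i ω) * Real.exp (∑ j ∈ T, a j * Y j ω) ≤
        2 * (Real.exp (a i ^ 2 / 2) * ∑ ω, Real.exp (∑ j ∈ T, a j * Y j ω)) := by
      rw [mul_sum, mul_sum]
      refine sum_le_sum fun ω _ => ?_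
      rw [mul_assoc]
      gcongr
      exact hcosh ω
    have hfin := mul_le_mul_of_nonneg_left ih' (Real.exp_pos (a i ^ 2 / 2)).le
    have : Real.exp (a i ^ 2 / 2) * (Fintype.card Ω * Real.exp ((∑ i ∈ T, a i ^ 2) / 2)) =
        Fintype.card Ω * Real.exp ((∑ i ∈ insert i T, a i ^ 2) / 2) := by
      rw [sum_insert hi, add_div, Real.exp_add]; ring
    linarith

theorem card_linear_ge_le {Ω ι : Type*} [Fintype Ω] [DecidableEq ι] (T : Finset ι)
    (Y : ι → Ω → ℝ) (σ : ι → Equiv.Perm Ω) (hle : ∀ i ∈ T, ∀ ω, |Y i ω| ≤ 1)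
    (hneg : ∀ i ∈ T, ∀ ω, Y i (σ i ω) = -Y i ω)
    (hfix : ∀ i ∈ T, ∀ j ∈ T, j ≠ i → ∀ ω, Y j (σ i ω) = Y j ω) (a : ι → ℝ)
    {s τ : ℝ} (hs : 0 < s) (hτ : 0 ≤ τ) (ha : ∑ i ∈ T, a i ^ 2 ≤ s)
    (P : Ω → Prop) [DecidablePred P] (hP : ∀ ω, P ω → τ ≤ ∑ i ∈ T, a i * Y i ω) :
    ((univ.filter P).card : ℝ) ≤ Fintype.card Ω * Real.exp (-(τ ^ 2 / (2 * s))) := by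
  have h := sum_exp_linear_le T Y σ hle hneg hfix (fun i => τ / s * a i)
  have h1 : ((univ.filter P).card : ℝ) * Real.exp (τ / s * τ) ≤
      ∑ ω, Real.exp (∑ i ∈ T, τ / s * a i * Y i ω) := by
    rw [← nsmul_eq_mul, ← sum_const]
    refine (sum_le_sum fun ω hω => ?_).trans
      (sum_le_sum_of_subset_of_nonneg (filter_subset P univ) fun _ _ _ => (Real.exp_pos _).le)
    have := hP ω (mem_filter.1 hω).2
    rw [Real.exp_le_exp]
    simp_rw [mul_assoc]
    rw [← mul_sum]
    gcongr
  have h2 : (∑ i ∈ T, (τ / s * a i) ^ 2) / 2 ≤ τ ^ 2 / (2 * s) := by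
    simp_rw [mul_pow]
    rw [← mul_sum]
    calc (τ / s) ^ 2 * (∑ i ∈ T, a i ^ 2) / 2 ≤ (τ / s) ^ 2 * s / 2 := by gcongr
      _ = _ := by field_simp
  have h3 : Real.exp (-(τ ^ 2 / (2 * s))) * Real.exp (τ / s * τ) = Real.exp (τ ^ 2 / (2 * s)) := by
    rw [← Real.exp_add]; congr 1; field_simp; ring
  refine le_of_mul_le_mul_right ?_ (Real.exp_pos (τ / s * τ))
  rw [mul_assoc, h3]
  refine (h1.trans h).trans ?_
  gcongr

open Classical in
/-- The `0/1` adjacency indicator of a graph, as a real number. -/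
noncomputable def adjInd {V : Type*} (G : SimpleGraph V) (i j : V) : ℝ :=
  if G.Adj i j then 1 else 0

/-- The `±1` adjacency sign of a graph (with `-1` on the diagonal). -/
noncomputable def adjSign {V : Type*} (G : SimpleGraph V) (i j : V) : ℝ :=
  2 * adjInd G i j - 1

theorem adjSign_comm {V : Type*} (G : SimpleGraph V) (i j : V) :
    adjSign G i j = adjSign G j i := by
  by_cases h : G.Adj i j
  · simp [adjSign, adjInd, h, h.symm]
  · have h' : ¬ G.Adj j i := fun e => h e.symm
    simp [adjSign, adjInd, h, h']

theorem adjSign_self {V : Type*} (G : SimpleGraph V) (i : V) : adjSign G i i = -1 := by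
  simp [adjSign, adjInd]

theorem abs_adjSign {V : Type*} (G : SimpleGraph V) (i j : V) : |adjSign G i j| = 1 := by
  unfold adjSign adjInd
  split_ifs <;> norm_num

theorem adjInd_nonneg {V : Type*} (G : SimpleGraph V) (i j : V) : 0 ≤ adjInd G i j := by
  unfold adjInd; split_ifs <;> norm_num

theorem adjInd_le_one {V : Type*} (G : SimpleGraph V) (i j : V) : adjInd G i j ≤ 1 := by
  unfold adjInd; split_ifs <;> norm_num

/-- Toggling the edge `ij`, as a permutation of the set of graphs. -/
def flipEdge {V : Type*} (i j : V) : Equiv.Perm (SimpleGraph V) where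
  toFun G := symmDiff G (SimpleGraph.edge i j)
  invFun G := symmDiff G (SimpleGraph.edge i j)
  left_inv _ := symmDiff_symmDiff_cancel_right _ _
  right_inv _ := symmDiff_symmDiff_cancel_right _ _

theorem flipEdge_adj {V : Type*} (i j u v : V) (G : SimpleGraph V) :
    (flipEdge i j G).Adj u v ↔
      (G.Adj u v ∧ ¬ (((u = i ∧ v = j) ∨ (u = j ∧ v = i)) ∧ u ≠ v)) ∨
      ((((u = i ∧ v = j) ∨ (u = j ∧ v = i)) ∧ u ≠ v) ∧ ¬ G.Adj u v) := by
  simp [flipEdge, symmDiff, SimpleGraph.sup_adj, SimpleGraph.sdiff_adj, SimpleGraph.edge_adj]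

theorem adjSign_flipEdge_self {V : Type*} {i j : V} (h : i ≠ j) (G : SimpleGraph V) :
    adjSign (flipEdge i j G) i j = -adjSign G i j := by
  have : (flipEdge i j G).Adj i j ↔ ¬ G.Adj i j := by
    rw [flipEdge_adj]; tauto
  unfold adjSign adjInd
  by_cases hG : G.Adj i j <;> simp [this, hG] <;> norm_num

theorem adjSign_flipEdge_of_ne {V : Type*} {i j u v : V} (G : SimpleGraph V)
    (h : ¬ (u = i ∧ v = j)) (h' : ¬ (u = j ∧ v = i)) :
    adjSign (flipEdge i j G) u v = adjSign G u v := by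
  have : (flipEdge i j G).Adj u v ↔ G.Adj u v := by
    rw [flipEdge_adj]; tauto
  by_cases hG : G.Adj u v <;> simp [adjSign, adjInd, this, hG]

open Classical in
/-- The number of graphs for which a signed sum of products of edge signs along a star is
large and negative. -/
theorem card_star_sum_le {V : Type*} [Fintype V] [DecidableEq V] (F : Finset V) (hF : F.Nonempty)
    {τ : ℝ} (hτ : 0 ≤ τ) (hV : 0 < Fintype.card V) :
    ((univ.filter fun G : SimpleGraph V =>
        ∑ v ∈ univ \ F, ∏ u ∈ F, adjSign G u v ≤ -τ).card : ℝ) ≤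
      Fintype.card (SimpleGraph V) * Real.exp (-(τ ^ 2 / (2 * Fintype.card V))) := by
  obtain ⟨u₀, hu₀⟩ := hF
  refine card_linear_ge_le (univ \ F) (fun v G => ∏ u ∈ F, adjSign G u v)
    (fun v => flipEdge u₀ v) ?_ ?_ ?_ (fun _ => -1) (by exact_mod_cast hV) hτ ?_ _ ?_
  · intro v _ G
    rw [abs_prod]
    simp [abs_adjSign]
  · intro v hv G
    have hv' : v ∉ F := (mem_sdiff.1 hv).2
    have hne : u₀ ≠ v := fun h => hv' (h ▸ hu₀)
    rw [← mul_prod_erase _ _ hu₀, ← mul_prod_erase _ _ hu₀, adjSign_flipEdge_self hne, neg_mul]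
    congr 2
    refine prod_congr rfl fun u hu => adjSign_flipEdge_of_ne G ?_ ?_
    · rintro ⟨rfl, -⟩; exact (mem_erase.1 hu).1 rfl
    · rintro ⟨rfl, -⟩; exact hv' (mem_erase.1 hu).2
  · intro v hv w hw hwv G
    have hv' : v ∉ F := (mem_sdiff.1 hv).2
    refine prod_congr rfl fun u hu => adjSign_flipEdge_of_ne G ?_ ?_
    · rintro ⟨-, rfl⟩; exact hwv rfl
    · rintro ⟨rfl, -⟩; exact hv' hu
  · simpa using card_le_card (subset_univ (univ \ F))
  · intro G hG
    simp only [neg_one_mul, sum_neg_distrib]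
    linarith

open Classical in
/-- The common neighbourhood of a vertex set. -/
noncomputable def commonNbrs {V : Type*} [Fintype V] (G : SimpleGraph V) (U : Finset V) :
    Finset V :=
  univ.filter fun v => ∀ u ∈ U, G.Adj u v

theorem mem_commonNbrs {V : Type*} [Fintype V] {G : SimpleGraph V} {U : Finset V} {v : V} :
    v ∈ commonNbrs G U ↔ ∀ u ∈ U, G.Adj u v := by
  simp [commonNbrs]

open Classical in
theorem card_commonNbrs {V : Type*} [Fintype V] (G : SimpleGraph V) (U : Finset V) :
    2 ^ U.card * ((commonNbrs G U).card : ℝ) =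
      ∑ F ∈ U.powerset, ∑ v, ∏ u ∈ F, adjSign G u v := by
  rw [sum_comm, commonNbrs, ← sum_boole, mul_sum]
  refine sum_congr rfl fun v _ => ?_
  rw [← prod_one_add]
  split_ifs with h
  · rw [mul_one, ← prod_const]
    refine prod_congr rfl fun u hu => ?_
    simp only [adjSign, adjInd, h u hu, if_true]
    norm_num
  · push Not at h
    obtain ⟨u, hu, huv⟩ := h
    rw [mul_zero, eq_comm]
    exact prod_eq_zero hu (by simp [adjSign, adjInd, huv])

/-- If no short star sum is very negative, then common neighbourhoods are large. -/
theorem card_commonNbrs_ge {V : Type*} [Fintype V] [DecidableEq V] (G : SimpleGraph V) {m : ℕ}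
    {τ : ℝ} (hτ : 0 ≤ τ)
    (h : ∀ F : Finset V, F.Nonempty → F.card ≤ m →
      -τ ≤ ∑ v ∈ univ \ F, ∏ u ∈ F, adjSign G u v)
    (U : Finset V) (hU : U.card ≤ m) :
    Fintype.card V - 2 ^ m * (τ + m) ≤ 2 ^ m * ((commonNbrs G U).card : ℝ) := by
  have h1 : (Fintype.card V : ℝ) - 2 ^ m * (τ + m) ≤
      ∑ F ∈ U.powerset, ∑ v, ∏ u ∈ F, adjSign G u v := by
    rw [← add_sum_erase _ _ (empty_mem_powerset U)]
    have h2 : ∀ F ∈ U.powerset.erase ∅, -(τ + m) ≤ ∑ v, ∏ u ∈ F, adjSign G u v := by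
      intro F hF
      obtain ⟨hne, hFU⟩ := mem_erase.1 hF
      have hcard : F.card ≤ m := (card_le_card (mem_powerset.1 hFU)).trans hU
      have h3 := h F (nonempty_iff_ne_empty.2 hne) hcard
      rw [← sum_sdiff (subset_univ F)]
      have h4 : -(m : ℝ) ≤ ∑ v ∈ F, ∏ u ∈ F, adjSign G u v := by
        have : |∑ v ∈ F, ∏ u ∈ F, adjSign G u v| ≤ m := by
          refine (abs_sum_le_sum_abs _ _).trans ?_
          simp only [abs_prod, abs_adjSign, prod_const_one, sum_const, nsmul_eq_mul, mul_one]
          exact_mod_cast hcard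
        exact (abs_le.1 this).1
      linarith
    have h5 := sum_le_sum h2
    have h6 : ((U.powerset.erase ∅).card : ℝ) ≤ 2 ^ m := by
      have : (U.powerset.erase ∅).card ≤ 2 ^ m := by
        refine (card_le_card (erase_subset _ _)).trans ?_
        rw [card_powerset]
        exact Nat.pow_le_pow_right (by norm_num) hU
      exact_mod_cast this
    rw [sum_const, nsmul_eq_mul] at h5
    have h7 : (0:ℝ) ≤ τ + m := by positivity
    simp only [prod_empty, sum_const, nsmul_eq_mul, mul_one, card_univ]
    nlinarith
  refine h1.trans ?_
  rw [← card_commonNbrs]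
  gcongr
  norm_num

theorem exists_int_round {n : ℕ} (hn : 0 < n) {t : ℝ} (ht : |t| ≤ 1) :
    ∃ z ∈ Icc (-(n : ℤ)) n, |(z : ℝ) / n| ≤ |t| ∧ |t - z / n| ≤ 1 / n := by
  have hn' : (0 : ℝ) < n := by exact_mod_cast hn
  wlog h0 : 0 ≤ t generalizing t with H
  · obtain ⟨z, hz, h1, h2⟩ := H (t := -t) (by simpa using ht) (by linarith)
    refine ⟨-z, ?_, ?_, ?_⟩
    · rw [mem_Icc] at hz ⊢; omega
    · rw [Int.cast_neg, neg_div, abs_neg]; simpa using h1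
    · rw [← abs_neg]
      convert h2 using 2
      push_cast; ring
  rw [abs_of_nonneg h0] at ht ⊢
  have hfl : (0 : ℤ) ≤ ⌊(n : ℝ) * t⌋ := Int.floor_nonneg.2 (by positivity)
  have hfl' : (0 : ℝ) ≤ (⌊(n : ℝ) * t⌋ : ℝ) := by exact_mod_cast hfl
  have hle : (⌊(n : ℝ) * t⌋ : ℝ) ≤ n * t := Int.floor_le _
  have hlt := Int.lt_floor_add_one ((n : ℝ) * t)
  refine ⟨⌊(n : ℝ) * t⌋, ?_, ?_, ?_⟩
  · rw [mem_Icc]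
    refine ⟨by omega, ?_⟩
    have : (⌊(n : ℝ) * t⌋ : ℝ) ≤ (n : ℤ) := by push_cast; nlinarith
    exact_mod_cast this
  · rw [abs_of_nonneg (by positivity), div_le_iff₀ hn']; linarith
  · have h1 : t - ⌊(n : ℝ) * t⌋ / n = (n * t - ⌊(n : ℝ) * t⌋) / n := by field_simp
    rw [h1, abs_of_nonneg (div_nonneg (by linarith) hn'.le)]
    gcongr
    linarith

/-- A finite net of the Euclidean unit ball, of mesh `n⁻¹ᐟ²`, contained in the ball. -/
theorem exists_ball_net {n : ℕ} (hn : 0 < n) :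
    ∃ N : Finset (Fin n → ℝ), N.card ≤ (2 * n + 1) ^ n ∧ (∀ x ∈ N, ∑ i, x i ^ 2 ≤ 1) ∧
      ∀ x : Fin n → ℝ, ∑ i, x i ^ 2 ≤ 1 → ∃ x' ∈ N, ∑ i, (x i - x' i) ^ 2 ≤ 1 / n := by
  classical
  have hn' : (0 : ℝ) < n := by exact_mod_cast hn
  refine ⟨((Fintype.piFinset fun _ : Fin n => Icc (-(n : ℤ)) n).image
    (fun z i => (z i : ℝ) / n)).filter (fun x => ∑ i, x i ^ 2 ≤ 1), ?_, ?_, ?_⟩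
  · refine (card_le_card (filter_subset _ _)).trans (card_image_le.trans ?_)
    rw [Fintype.card_piFinset_const, Int.card_Icc]
    apply le_of_eq
    congr 1
    omega
  · intro x hx
    exact (mem_filter.1 hx).2
  · intro x hx
    have hx1 : ∀ i, |x i| ≤ 1 := fun i =>
      (sq_le_one_iff_abs_le_one _).1
        ((single_le_sum (f := fun i => x i ^ 2) (fun _ _ => sq_nonneg _) (mem_univ i)).trans hx)
    choose z hz h1 h2 using fun i => exists_int_round hn (hx1 i)
    refine ⟨fun i => z i / n, mem_filter.2 ⟨mem_image.2 ⟨z, ?_, rfl⟩, ?_⟩, ?_⟩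
    · exact Fintype.mem_piFinset.2 hz
    · exact (sum_le_sum fun i _ => sq_le_sq.2 (h1 i)).trans hx
    · calc ∑ i, (x i - z i / n) ^ 2 ≤ ∑ _i : Fin n, (1 / (n : ℝ)) ^ 2 := by
            refine sum_le_sum fun i _ => sq_le_sq.2 ((h2 i).trans (le_abs_self _))
        _ = 1 / n := by simp; field_simp

theorem sum_sum_eq_lt_add_diag {n : ℕ} (f : Fin n → Fin n → ℝ) :
    ∑ i, ∑ j, f i j = ∑ p ∈ univ.filter (fun p : Fin n × Fin n => p.1 < p.2),
      (f p.1 p.2 + f p.2 p.1) + ∑ i, f i i := by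
  have h1 : ∀ i j, f i j = (if i < j then f i j else 0) + (if j < i then f i j else 0) +
      (if i = j then f i j else 0) := by
    intro i j
    rcases lt_trichotomy i j with h | h | h
    · simp [h, h.ne, h.le]
    · simp [h]
    · simp [h, h.ne', h.le]
  rw [sum_filter, Fintype.sum_prod_type]
  calc ∑ i, ∑ j, f i j = ∑ i, ∑ j, (if i < j then f i j else 0) +
        ∑ i, ∑ j, (if j < i then f i j else 0) + ∑ i, ∑ j, (if i = j then f i j else 0) := by
        simp_rw [← sum_add_distrib]
        exact sum_congr rfl fun i _ => sum_congr rfl fun j _ => h1 i j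
    _ = _ := by
        congr 1
        · rw [sum_comm (f := fun i j => if j < i then f i j else 0)]
          simp_rw [← sum_add_distrib]
          refine sum_congr rfl fun i _ => sum_congr rfl fun j _ => ?_
          split_ifs <;> simp
        · simp

/-- The bilinear form of the centred adjacency matrix. -/
noncomputable def centredForm {V : Type*} [Fintype V] (G : SimpleGraph V) (x y : V → ℝ) : ℝ :=
  ∑ i, ∑ j, x i * y j * (adjInd G i j - 1 / 2)

theorem centredForm_eq {n : ℕ} (G : SimpleGraph (Fin n)) (x y : Fin n → ℝ) :
    centredForm G x y = ∑ p ∈ univ.filter (fun p : Fin n × Fin n => p.1 < p.2),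
      ((x p.1 * y p.2 + x p.2 * y p.1) / 2) * adjSign G p.1 p.2 - 1 / 2 * ∑ i, x i * y i := by
  unfold centredForm
  rw [sum_sum_eq_lt_add_diag, sub_eq_add_neg, mul_sum, ← sum_neg_distrib]
  have h : ∀ i j, adjInd G i j - 1 / 2 = adjSign G i j / 2 := fun i j => by
    unfold adjSign; ring
  congr 1
  · refine sum_congr rfl fun p _ => ?_
    rw [h, h, adjSign_comm G p.2 p.1]
    ring
  · refine sum_congr rfl fun i _ => ?_
    rw [h, adjSign_self]
    ring

theorem abs_centredForm_le {V : Type*} [Fintype V] (G : SimpleGraph V) (x y : V → ℝ) :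
    |centredForm G x y| ≤ 1 / 2 * ((∑ i, |x i|) * ∑ j, |y j|) := by
  unfold centredForm
  rw [sum_mul_sum, mul_sum]
  refine (abs_sum_le_sum_abs _ _).trans (sum_le_sum fun i _ => ?_)
  rw [mul_sum]
  refine (abs_sum_le_sum_abs _ _).trans (sum_le_sum fun j _ => ?_)
  rw [abs_mul, abs_mul, mul_comm]
  gcongr
  unfold adjInd
  split_ifs <;> norm_num [abs_le]

theorem sum_abs_le_sqrt {V : Type*} [Fintype V] (x : V → ℝ) {B : ℝ} (h : ∑ i, x i ^ 2 ≤ B) :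
    ∑ i, |x i| ≤ √(Fintype.card V * B) := by
  apply Real.le_sqrt_of_sq_le
  refine (sq_sum_le_card_mul_sum_sq (s := univ) (f := fun i => |x i|)).trans ?_
  simp only [sq_abs, card_univ]
  gcongr

theorem centredForm_sub_left {V : Type*} [Fintype V] (G : SimpleGraph V) (x x' y : V → ℝ) :
    centredForm G (fun i => x i - x' i) y = centredForm G x y - centredForm G x' y := by
  simp only [centredForm, ← sum_sub_distrib]
  refine sum_congr rfl fun i _ => sum_congr rfl fun j _ => by ring

theorem centredForm_sub_right {V : Type*} [Fintype V] (G : SimpleGraph V) (x y y' : V → ℝ) :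
    centredForm G x (fun i => y i - y' i) = centredForm G x y - centredForm G x y' := by
  simp only [centredForm, ← sum_sub_distrib]
  refine sum_congr rfl fun i _ => sum_congr rfl fun j _ => by ring

theorem centredForm_smul {V : Type*} [Fintype V] (G : SimpleGraph V) (x y : V → ℝ) (a b : ℝ) :
    centredForm G (fun i => a * x i) (fun i => b * y i) = a * b * centredForm G x y := by
  simp only [centredForm, mul_sum]
  refine sum_congr rfl fun i _ => sum_congr rfl fun j _ => by ring

/-- `β` bounds the operator norm of the centred adjacency matrix of `G`. -/
def CentredNormLE {V : Type*} [Fintype V] (G : SimpleGraph V) (β : ℝ) : Prop :=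
  ∀ x y : V → ℝ, |centredForm G x y| ≤ β * (√(∑ i, x i ^ 2) * √(∑ i, y i ^ 2))

theorem centredNormLE_of_ball {V : Type*} [Fintype V] (G : SimpleGraph V) {β : ℝ}
    (h : ∀ x y : V → ℝ, ∑ i, x i ^ 2 ≤ 1 → ∑ i, y i ^ 2 ≤ 1 → centredForm G x y ≤ β) :
    CentredNormLE G β := by
  intro x y
  set a := √(∑ i, x i ^ 2) with ha
  set b := √(∑ i, y i ^ 2) with hb
  have ha2 : a ^ 2 = ∑ i, x i ^ 2 := Real.sq_sqrt (sum_nonneg fun _ _ => sq_nonneg _)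
  have hb2 : b ^ 2 = ∑ i, y i ^ 2 := Real.sq_sqrt (sum_nonneg fun _ _ => sq_nonneg _)
  have ha0 : 0 ≤ a := Real.sqrt_nonneg _
  have hb0 : 0 ≤ b := Real.sqrt_nonneg _
  rcases ha0.eq_or_lt with h0 | hapos
  · have hx : ∀ i, x i = 0 := fun i => by
      rw [← h0, eq_comm] at ha2
      have := (sum_eq_zero_iff_of_nonneg fun i _ => sq_nonneg (x i)).1 (by simpa using ha2) i
      simpa using this
    simp [centredForm, hx, ← h0]
  rcases hb0.eq_or_lt with h0 | hbpos
  · have hy : ∀ i, y i = 0 := fun i => by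
      rw [← h0, eq_comm] at hb2
      have := (sum_eq_zero_iff_of_nonneg fun i _ => sq_nonneg (y i)).1 (by simpa using hb2) i
      simpa using this
    simp [centredForm, hy, ← h0]
  have key : ∀ e : ℝ, e ^ 2 = 1 → e * centredForm G x y ≤ β * (a * b) := by
    intro e he
    have := h (fun i => (e / a) * x i) (fun i => b⁻¹ * y i) ?_ ?_
    · rw [centredForm_smul] at this
      have h2 : e * centredForm G x y = (e / a * b⁻¹ * centredForm G x y) * (a * b) := by
        field_simp
      rw [h2]
      gcongr
    · simp_rw [mul_pow]
      rw [← mul_sum, ← ha2, div_pow, he]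
      field_simp
      norm_num
    · simp_rw [mul_pow]
      rw [← mul_sum, ← hb2]
      field_simp
      norm_num
  rw [abs_le]
  constructor
  · linarith [key (-1) (by norm_num)]
  · linarith [key 1 (by norm_num)]

theorem sum_sq_symm_le {n : ℕ} (x y : Fin n → ℝ) (hx : ∑ i, x i ^ 2 ≤ 1)
    (hy : ∑ i, y i ^ 2 ≤ 1) :
    ∑ p ∈ univ.filter (fun p : Fin n × Fin n => p.1 < p.2),
      ((x p.1 * y p.2 + x p.2 * y p.1) / 2) ^ 2 ≤ 1 := by
  have h1 := sum_sum_eq_lt_add_diag fun i j => x i ^ 2 * y j ^ 2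
  have h2 : ∑ i, ∑ j, x i ^ 2 * y j ^ 2 ≤ 1 := by
    rw [← sum_mul_sum]
    exact mul_le_one₀ hx (sum_nonneg fun _ _ => sq_nonneg _) hy
  have h3 : 0 ≤ ∑ i, x i ^ 2 * y i ^ 2 := sum_nonneg fun _ _ => by positivity
  refine le_trans (sum_le_sum fun p _ => ?_) (show ∑ p ∈ univ.filter
    (fun p : Fin n × Fin n => p.1 < p.2), (x p.1 ^ 2 * y p.2 ^ 2 + x p.2 ^ 2 * y p.1 ^ 2) ≤ 1 by
      linarith)
  nlinarith [sq_nonneg (x p.1 * y p.2 - x p.2 * y p.1), sq_nonneg (x p.1 * y p.2 + x p.2 * y p.1)]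

open Classical in
theorem card_not_centredNormLE {n : ℕ} (hn : 0 < n) {τ : ℝ} (hτ : 0 ≤ τ) :
    ((univ.filter fun G : SimpleGraph (Fin n) =>
        ¬ CentredNormLE G (τ + 1 / 2 + √n)).card : ℝ) ≤
      Fintype.card (SimpleGraph (Fin n)) *
        ((2 * n + 1) ^ (2 * n) * Real.exp (-(τ ^ 2 / 2))) := by
  have hn' : (0 : ℝ) < n := by exact_mod_cast hn
  obtain ⟨N, hNc, hN1, hNd⟩ := exists_ball_net hn
  let bad : (Fin n → ℝ) × (Fin n → ℝ) → Finset (SimpleGraph (Fin n)) := fun p =>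
    univ.filter fun G => τ ≤ ∑ q ∈ univ.filter (fun q : Fin n × Fin n => q.1 < q.2),
      ((p.1 q.1 * p.2 q.2 + p.1 q.2 * p.2 q.1) / 2) * adjSign G q.1 q.2
  have hbad : ∀ p ∈ N ×ˢ N, ((bad p).card : ℝ) ≤
      Fintype.card (SimpleGraph (Fin n)) * Real.exp (-(τ ^ 2 / 2)) := by
    intro p hp
    obtain ⟨hp1, hp2⟩ := mem_product.1 hp
    have := card_linear_ge_le (univ.filter (fun q : Fin n × Fin n => q.1 < q.2))
      (fun q G => adjSign G q.1 q.2) (fun q => flipEdge q.1 q.2)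
      (fun q _ G => (abs_adjSign G _ _).le)
      (fun q hq G => adjSign_flipEdge_self (mem_filter.1 hq).2.ne G)
      ?_ (fun q => (p.1 q.1 * p.2 q.2 + p.1 q.2 * p.2 q.1) / 2)
      one_pos hτ (sum_sq_symm_le _ _ (hN1 _ hp1) (hN1 _ hp2))
      (fun G => τ ≤ ∑ q ∈ univ.filter (fun q : Fin n × Fin n => q.1 < q.2),
      ((p.1 q.1 * p.2 q.2 + p.1 q.2 * p.2 q.1) / 2) * adjSign G q.1 q.2) (fun G h => h)
    · simpa using this
    · rintro ⟨i, j⟩ hq ⟨u, v⟩ hq' hne G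
      have h1 : i < j := (mem_filter.1 hq).2
      have h2 : u < v := (mem_filter.1 hq').2
      refine adjSign_flipEdge_of_ne G ?_ ?_
      · rintro ⟨rfl, rfl⟩; exact hne rfl
      · rintro ⟨rfl, rfl⟩; exact lt_asymm h1 h2
  have hsub : (univ.filter fun G : SimpleGraph (Fin n) =>
      ¬ CentredNormLE G (τ + 1 / 2 + √n)) ⊆ (N ×ˢ N).biUnion bad := by
    intro G hG
    by_contra hnot
    refine (mem_filter.1 hG).2 (centredNormLE_of_ball G fun x y hx hy => ?_)
    obtain ⟨x', hx', hxd⟩ := hNd x hx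
    obtain ⟨y', hy', hyd⟩ := hNd y hy
    have h1 : centredForm G x' y' ≤ τ + 1 / 2 := by
      have hlt : ∑ q ∈ univ.filter (fun q : Fin n × Fin n => q.1 < q.2),
          ((x' q.1 * y' q.2 + x' q.2 * y' q.1) / 2) * adjSign G q.1 q.2 < τ := by
        by_contra hle
        exact hnot (mem_biUnion.2 ⟨(x', y'), mem_product.2 ⟨hx', hy'⟩,
          mem_filter.2 ⟨mem_univ _, not_lt.1 hle⟩⟩)
      have hin : -1 ≤ ∑ i, x' i * y' i := by
        have : ∑ i, -(x' i * y' i) ≤ ∑ i, (x' i ^ 2 + y' i ^ 2) / 2 :=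
          sum_le_sum fun i _ => by nlinarith [sq_nonneg (x' i + y' i)]
        rw [← sum_div, sum_add_distrib, sum_neg_distrib] at this
        linarith [hN1 x' hx', hN1 y' hy']
      rw [centredForm_eq]
      linarith
    have hsmall : ∀ u v : Fin n → ℝ, ∑ i, u i ^ 2 ≤ 1 / n → ∑ i, v i ^ 2 ≤ 1 →
        1 / 2 * ((∑ i, |u i|) * ∑ i, |v i|) ≤ 1 / 2 * √n := by
      intro u v hu hv
      have h1 := sum_abs_le_sqrt u hu
      have h2 := sum_abs_le_sqrt v hv
      rw [Fintype.card_fin, mul_one_div_cancel hn'.ne', Real.sqrt_one] at h1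
      rw [Fintype.card_fin, mul_one] at h2
      gcongr
      calc (∑ i, |u i|) * ∑ i, |v i| ≤ 1 * √n := by gcongr
        _ = _ := one_mul _
    have h2 : centredForm G (fun i => x i - x' i) y' ≤ 1 / 2 * √n :=
      ((le_abs_self _).trans (abs_centredForm_le _ _ _)).trans (hsmall _ _ hxd (hN1 y' hy'))
    have h3 : centredForm G x (fun i => y i - y' i) ≤ 1 / 2 * √n := by
      refine ((le_abs_self _).trans (abs_centredForm_le _ _ _)).trans ?_
      rw [mul_comm (∑ i, |x i|)]
      exact hsmall _ _ hyd hx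
    rw [centredForm_sub_left] at h2
    rw [centredForm_sub_right] at h3
    linarith
  have hcard : ((univ.filter fun G : SimpleGraph (Fin n) =>
      ¬ CentredNormLE G (τ + 1 / 2 + √n)).card : ℝ) ≤ ∑ p ∈ N ×ˢ N, ((bad p).card : ℝ) := by
    exact_mod_cast (card_le_card hsub).trans card_biUnion_le
  refine (hcard.trans (sum_le_sum hbad)).trans ?_
  rw [sum_const, nsmul_eq_mul, card_product]
  have hNN : ((N.card * N.card : ℕ) : ℝ) ≤ (2 * n + 1) ^ (2 * n) := by
    have : N.card * N.card ≤ (2 * n + 1) ^ (2 * n) := by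
      rw [two_mul n, pow_add]
      simpa [two_mul] using Nat.mul_le_mul hNc hNc
    exact_mod_cast this
  calc ((N.card * N.card : ℕ) : ℝ) * (Fintype.card (SimpleGraph (Fin n)) * Real.exp (-(τ ^ 2 / 2)))
      ≤ (2 * n + 1) ^ (2 * n) *
        (Fintype.card (SimpleGraph (Fin n)) * Real.exp (-(τ ^ 2 / 2))) := by gcongr
    _ = _ := by ring

section Slices

variable {V κ : Type*} [Fintype V] [Fintype κ] [DecidableEq κ]

theorem sum_sum_update (a : κ) (F : (κ → V) → ℝ) :
    ∑ f, ∑ v, F (Function.update f a v) = Fintype.card V * ∑ f, F f := by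
  let e : (κ → V) × V ≃ (κ → V) × V :=
    { toFun := fun p => (Function.update p.1 a p.2, p.1 a)
      invFun := fun p => (Function.update p.1 a p.2, p.1 a)
      left_inv := fun p => by simp
      right_inv := fun p => by simp }
  have h := Equiv.sum_comp e (fun p => F p.1)
  rw [Fintype.sum_prod_type, Fintype.sum_prod_type] at h
  rw [show ∑ f, ∑ v, F (Function.update f a v) =
    ∑ x : κ → V, ∑ y : V, F (e (x, y)).1 from rfl, h, mul_sum]
  simp

theorem sum_sqrt_slice_le (a : κ) (y : (κ → V) → ℝ) :
    ∑ f, √(∑ v, y (Function.update f a v) ^ 2) ≤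
      √(Fintype.card V ^ Fintype.card κ * (Fintype.card V * ∑ f, y f ^ 2)) := by
  apply Real.le_sqrt_of_sq_le
  refine (sq_sum_le_card_mul_sum_sq (s := univ)).trans (le_of_eq ?_)
  rw [card_univ, Fintype.card_fun, Nat.cast_pow, ← sum_sum_update a fun f => y f ^ 2]
  congr 1
  exact sum_congr rfl fun f _ => Real.sq_sqrt (sum_nonneg fun _ _ => sq_nonneg _)

/-- A bilinear form on tuples whose kernel contains a centred adjacency factor, the other factors
each missing one of the two coordinates involved, inherits the norm bound of that factor. -/
theorem abs_sum_centred_le [Nonempty V] (G : SimpleGraph V) {β : ℝ} (hG : CentredNormLE G β)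
    (hβ : 0 ≤ β) (a b : κ) (φ ψ : (κ → V) → (κ → V) → ℝ)
    (hφ : ∀ f g v, φ f (Function.update g b v) = φ f g)
    (hψ : ∀ f g v, ψ (Function.update f a v) g = ψ f g)
    (hφ1 : ∀ f g, |φ f g| ≤ 1) (hψ1 : ∀ f g, |ψ f g| ≤ 1) (y z : (κ → V) → ℝ) :
    (Fintype.card V : ℝ) * |∑ f, ∑ g, y f * z g * ((adjInd G (f a) (g b) - 1 / 2) * (φ f g * ψ f g))| ≤
      β * Fintype.card V ^ Fintype.card κ * (√(∑ f, y f ^ 2) * √(∑ g, z g ^ 2)) := by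
  set n : ℝ := (Fintype.card V : ℝ) with hn
  have hnpos : 0 < n := by rw [hn]; exact_mod_cast Fintype.card_pos
  set H : (κ → V) → (κ → V) → ℝ := fun f g =>
    y f * z g * ((adjInd G (f a) (g b) - 1 / 2) * (φ f g * ψ f g)) with hH
  have h1 : n * (n * ∑ f, ∑ g, H f g) = ∑ f, ∑ g, ∑ u, ∑ v,
      H (Function.update f a u) (Function.update g b v) := by
    rw [← sum_sum_update a fun f => ∑ g, H f g, mul_sum]
    refine sum_congr rfl fun f _ => ?_
    rw [mul_sum, sum_comm]
    refine sum_congr rfl fun u _ => ?_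
    rw [← sum_sum_update b]
  have h2 : ∀ f g, |∑ u, ∑ v, H (Function.update f a u) (Function.update g b v)| ≤
      β * (√(∑ v, y (Function.update f a v) ^ 2) * √(∑ v, z (Function.update g b v) ^ 2)) := by
    intro f g
    have h3 := hG (fun u => y (Function.update f a u) * φ (Function.update f a u) g)
      (fun v => z (Function.update g b v) * ψ f (Function.update g b v))
    have h4 : ∑ u, ∑ v, H (Function.update f a u) (Function.update g b v) =
        centredForm G (fun u => y (Function.update f a u) * φ (Function.update f a u) g)
          (fun v => z (Function.update g b v) * ψ f (Function.update g b v)) := by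
      refine sum_congr rfl fun u _ => sum_congr rfl fun v _ => ?_
      simp only [hH, hφ, hψ, Function.update_self]
      ring
    rw [h4]
    refine h3.trans ?_
    have hsq : ∀ p q : ℝ, |q| ≤ 1 → (p * q) ^ 2 ≤ p ^ 2 := fun p q hq => by
      rw [mul_pow]
      exact mul_le_of_le_one_right (sq_nonneg _) ((sq_le_one_iff_abs_le_one _).2 hq)
    exact mul_le_mul_of_nonneg_left (mul_le_mul
      (Real.sqrt_le_sqrt (sum_le_sum fun _ _ => hsq _ _ (hφ1 _ _)))
      (Real.sqrt_le_sqrt (sum_le_sum fun _ _ => hsq _ _ (hψ1 _ _)))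
      (Real.sqrt_nonneg _) (Real.sqrt_nonneg _)) hβ
  have h5 : n * (n * |∑ f, ∑ g, H f g|) ≤
      n * (β * n ^ Fintype.card κ * (√(∑ f, y f ^ 2) * √(∑ g, z g ^ 2))) := by
    calc n * (n * |∑ f, ∑ g, H f g|) = |n * (n * ∑ f, ∑ g, H f g)| := by
          rw [abs_mul, abs_mul, abs_of_pos hnpos]
      _ ≤ ∑ f, ∑ g, β * (√(∑ v, y (Function.update f a v) ^ 2) *
            √(∑ v, z (Function.update g b v) ^ 2)) := by
          rw [h1]
          refine (abs_sum_le_sum_abs _ _).trans (sum_le_sum fun f _ => ?_)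
          exact (abs_sum_le_sum_abs _ _).trans (sum_le_sum fun g _ => h2 f g)
      _ = β * ((∑ f, √(∑ v, y (Function.update f a v) ^ 2)) *
            ∑ g, √(∑ v, z (Function.update g b v) ^ 2)) := by
          rw [sum_mul_sum, mul_sum]
          exact sum_congr rfl fun f _ => by rw [mul_sum]
      _ ≤ β * (√(n ^ Fintype.card κ * (n * ∑ f, y f ^ 2)) *
            √(n ^ Fintype.card κ * (n * ∑ g, z g ^ 2))) := by
          exact mul_le_mul_of_nonneg_left (mul_le_mul (sum_sqrt_slice_le a y)
            (sum_sqrt_slice_le b z) (sum_nonneg fun _ _ => Real.sqrt_nonneg _)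
            (Real.sqrt_nonneg _)) hβ
      _ = _ := by
          simp only [← mul_assoc (n ^ Fintype.card κ) n]
          rw [Real.sqrt_mul (show 0 ≤ n ^ Fintype.card κ * n by positivity),
            Real.sqrt_mul (show 0 ≤ n ^ Fintype.card κ * n by positivity)]
          have := Real.mul_self_sqrt (show 0 ≤ n ^ Fintype.card κ * n by positivity)
          linear_combination (β * (√(∑ f, y f ^ 2) * √(∑ g, z g ^ 2))) * this
  exact le_of_mul_le_mul_left h5 hnpos

theorem abs_sum_prod_adjInd_sub_le [Nonempty V] (G : SimpleGraph V) {β : ℝ}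
    (hG : CentredNormLE G β) (hβ : 0 ≤ β) (E : Finset (κ × κ)) (y z : (κ → V) → ℝ) :
    (Fintype.card V : ℝ) *
        |∑ f, ∑ g, y f * z g * (∏ e ∈ E, adjInd G (f e.1) (g e.2) - (1 / 2) ^ E.card)| ≤
      E.card * (β * Fintype.card V ^ Fintype.card κ * (√(∑ f, y f ^ 2) * √(∑ g, z g ^ 2))) := by
  induction E using Finset.induction_on with
  | empty => simp
  | insert e E he ih =>
    set B := β * (Fintype.card V : ℝ) ^ Fintype.card κ * (√(∑ f, y f ^ 2) * √(∑ g, z g ^ 2))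
    have hB : 0 ≤ B := by positivity
    have habs : ∀ (s : Finset (κ × κ)) (f g : κ → V),
        |∏ e ∈ s, adjInd G (f e.1) (g e.2)| ≤ 1 := fun s f g => by
      rw [abs_prod]
      refine prod_le_one (fun _ _ => abs_nonneg _) fun e _ => ?_
      rw [abs_of_nonneg (adjInd_nonneg _ _ _)]
      exact adjInd_le_one _ _ _
    have h1 := abs_sum_centred_le G hG hβ e.1 e.2
      (fun f g => ∏ d ∈ E.filter (fun d => d.1 = e.1), adjInd G (f d.1) (g d.2))
      (fun f g => ∏ d ∈ E.filter (fun d => ¬ d.1 = e.1), adjInd G (f d.1) (g d.2))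
      (fun f g v => prod_congr rfl fun d hd => by
        obtain ⟨hdE, hd1⟩ := mem_filter.1 hd
        rw [Function.update_of_ne]
        exact fun h => he (by rwa [← Prod.ext hd1 h]))
      (fun f g v => prod_congr rfl fun d hd => by
        rw [Function.update_of_ne (mem_filter.1 hd).2])
      (fun f g => habs _ f g) (fun f g => habs _ f g) y z
    have h2 : ∑ f, ∑ g, y f * z g *
        (∏ e ∈ insert e E, adjInd G (f e.1) (g e.2) - (1 / 2) ^ (insert e E).card) =
        ∑ f, ∑ g, y f * z g * ((adjInd G (f e.1) (g e.2) - 1 / 2) *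
          ((∏ d ∈ E.filter (fun d => d.1 = e.1), adjInd G (f d.1) (g d.2)) *
          ∏ d ∈ E.filter (fun d => ¬ d.1 = e.1), adjInd G (f d.1) (g d.2))) +
        1 / 2 * ∑ f, ∑ g, y f * z g * (∏ e ∈ E, adjInd G (f e.1) (g e.2) - (1 / 2) ^ E.card) := by
      rw [mul_sum, ← sum_add_distrib]
      refine sum_congr rfl fun f _ => ?_
      rw [mul_sum, ← sum_add_distrib]
      refine sum_congr rfl fun g _ => ?_
      rw [prod_insert he, card_insert_of_notMem he, prod_filter_mul_prod_filter_not]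
      ring
    rw [h2, card_insert_of_notMem he]
    push_cast
    refine (mul_le_mul_of_nonneg_left (abs_add_le _ _) (Nat.cast_nonneg _)).trans ?_
    rw [abs_mul, abs_of_pos (show (0:ℝ) < 1 / 2 by norm_num)]
    have h3 : (0:ℝ) ≤ E.card * B := by positivity
    nlinarith

/-- The quadratic form with kernel `∏ A(fₚ, f_q)` over a family of tuples is nonnegative up to
an error governed by the norm of the centred adjacency matrix. -/
theorem neg_le_sum_prod_adjInd [Nonempty V] (G : SimpleGraph V) {β : ℝ}
    (hG : CentredNormLE G β) (hβ : 0 ≤ β) {ι : Type*} (P : Finset ι) (e : ι → κ → V)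
    (he : Set.InjOn e P) (y : ι → ℝ) :
    -((Fintype.card κ : ℝ) ^ 2 * β * Fintype.card V ^ Fintype.card κ * ∑ p ∈ P, y p ^ 2) ≤
      Fintype.card V * ∑ p ∈ P, ∑ q ∈ P, y p * y q * ∏ d : κ × κ, adjInd G (e p d.1) (e q d.2) := by
  classical
  let Y : (κ → V) → ℝ := fun f => ∑ p ∈ P with e p = f, y p
  have hY : ∀ p ∈ P, Y (e p) = y p := fun p hp => by
    have : (P.filter fun q => e q = e p) = {p} := by
      ext q
      simp only [mem_filter, mem_singleton]
      exact ⟨fun h => he h.1 hp h.2, fun h => by rw [h]; exact ⟨hp, rfl⟩⟩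
    simp only [Y, this, sum_singleton]
  have hsum : ∀ F : (κ → V) → ℝ, ∑ f, Y f * F f = ∑ p ∈ P, y p * F (e p) := fun F => by
    rw [← sum_fiberwise P e]
    refine sum_congr rfl fun f _ => ?_
    rw [sum_mul]
    refine sum_congr rfl fun p hp => ?_
    rw [(mem_filter.1 hp).2]
  have hsq : ∑ f, Y f ^ 2 = ∑ p ∈ P, y p ^ 2 := by
    simp_rw [sq]
    rw [hsum]
    exact sum_congr rfl fun p hp => by rw [hY p hp]
  have h := abs_sum_prod_adjInd_sub_le G hG hβ univ Y Y
  rw [Real.mul_self_sqrt (sum_nonneg fun _ _ => sq_nonneg _), hsq] at h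
  set c : ℝ := (1 / 2) ^ (univ : Finset (κ × κ)).card
  have hc : 0 ≤ c := by positivity
  have h1 : ∑ f, ∑ g, Y f * Y g * (∏ d : κ × κ, adjInd G (f d.1) (g d.2) - c) =
      ∑ p ∈ P, ∑ q ∈ P, y p * y q * ∏ d : κ × κ, adjInd G (e p d.1) (e q d.2) -
        c * (∑ p ∈ P, y p) ^ 2 := by
    have h2 : ∀ f, ∑ g, Y f * Y g * (∏ d : κ × κ, adjInd G (f d.1) (g d.2) - c) =
        Y f * ∑ q ∈ P, y q * (∏ d : κ × κ, adjInd G (f d.1) (e q d.2) - c) := fun f => by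
      rw [← hsum fun g => ∏ d : κ × κ, adjInd G (f d.1) (g d.2) - c, mul_sum]
      exact sum_congr rfl fun g _ => by ring
    simp_rw [h2]
    rw [hsum, sq, sum_mul_sum, mul_sum, ← sum_sub_distrib]
    refine sum_congr rfl fun p _ => ?_
    rw [mul_sum, mul_sum, ← sum_sub_distrib]
    exact sum_congr rfl fun q _ => by ring
  rw [h1] at h
  have h3 : (Fintype.card V : ℝ) * (∑ p ∈ P, ∑ q ∈ P, y p * y q *
      ∏ d : κ × κ, adjInd G (e p d.1) (e q d.2) - c * (∑ p ∈ P, y p) ^ 2) ≤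
      Fintype.card V * ∑ p ∈ P, ∑ q ∈ P, y p * y q *
      ∏ d : κ × κ, adjInd G (e p d.1) (e q d.2) := by
    gcongr
    have := mul_nonneg hc (sq_nonneg (∑ p ∈ P, y p))
    linarith
  refine le_trans ?_ h3
  have h4 := neg_le_neg h
  have h5 : ((univ : Finset (κ × κ)).card : ℝ) = (Fintype.card κ : ℝ) ^ 2 := by
    rw [card_univ, Fintype.card_prod]; push_cast; ring
  rw [h5] at h4
  refine le_trans (le_of_eq (by ring)) (h4.trans ?_)
  rw [← mul_neg]
  gcongr
  exact neg_abs_le _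

end Slices

open Classical in
theorem degG_eq_card {n : ℕ} (G : SimpleGraph (Fin n)) (r : ℕ) (I : Finset (Fin n)) :
    degG G r I = (univ.filter fun S : Finset (Fin n) =>
      I ⊆ S ∧ S.card = 2 * r ∧ G.IsClique (S : Set (Fin n))).card := by
  rw [degG, Nat.card_eq_fintype_card, Fintype.card_subtype]

/-- If all small vertex sets have at least `m` common neighbours, then every clique extends to
many cliques of size `2r`. -/
theorem pow_le_degG {n : ℕ} (G : SimpleGraph (Fin n)) {r : ℕ} (hr : 1 ≤ r) {m : ℝ} (hm : 0 ≤ m)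
    (h : ∀ U : Finset (Fin n), U.card ≤ 2 * r → m ≤ (commonNbrs G U).card)
    (t : ℕ) (U : Finset (Fin n)) (hU : U.card + t = 2 * r)
    (hc : G.IsClique (U : Set (Fin n))) : (m / (2 * r)) ^ t ≤ degG G r U := by
  classical
  induction t generalizing U with
  | zero =>
    rw [pow_zero, degG_eq_card, Nat.one_le_cast, Nat.one_le_iff_ne_zero, card_ne_zero]
    exact ⟨U, by simp; exact ⟨by omega, hc⟩⟩
  | succ t ih =>
    have hr' : (0 : ℝ) < 2 * r := by
      have : (1 : ℝ) ≤ r := by exact_mod_cast hr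
      linarith
    have h1 : ∀ v ∈ commonNbrs G U, (m / (2 * r)) ^ t ≤ degG G r (insert v U) := by
      intro v hv
      have hv' : ∀ u ∈ U, G.Adj u v := mem_commonNbrs.1 hv
      have hvU : v ∉ U := fun hvU => G.loopless.irrefl v (hv' v hvU)
      refine ih _ (by rw [card_insert_of_notMem hvU]; omega) ?_
      rw [coe_insert, SimpleGraph.isClique_insert]
      exact ⟨hc, fun u hu _ => (hv' u hu).symm⟩
    have h2 : ∑ v ∈ commonNbrs G U, degG G r (insert v U) ≤ 2 * r * degG G r U := by
      simp_rw [degG_eq_card, card_filter]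
      rw [sum_comm, mul_sum]
      refine sum_le_sum fun S _ => ?_
      by_cases hS : U ⊆ S ∧ S.card = 2 * r ∧ G.IsClique (S : Set (Fin n))
      · rw [if_pos hS, mul_one, ← card_filter, ← hS.2.1]
        refine card_le_card fun v hv => ?_
        exact (mem_filter.1 hv).2.1 (mem_insert_self _ _)
      · rw [if_neg hS, mul_zero, Nat.le_zero]
        refine sum_eq_zero fun v _ => if_neg fun hv => hS ⟨(subset_insert _ _).trans hv.1, hv.2⟩
    have h3 : ((commonNbrs G U).card : ℝ) * (m / (2 * r)) ^ t ≤ 2 * r * degG G r U := by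
      rw [← nsmul_eq_mul, ← sum_const]
      refine (sum_le_sum h1).trans ?_
      exact_mod_cast h2
    have h4 : m * (m / (2 * r)) ^ t ≤ 2 * r * degG G r U := by
      refine le_trans ?_ h3
      gcongr
      exact h U (by omega)
    rw [pow_succ', div_mul_eq_mul_div, div_le_iff₀ hr']
    linarith

open Classical in
/-- The indicator that `T` is disjoint from `I` and `I ∪ T` is a clique. -/
noncomputable def extInd {V : Type*} [DecidableEq V] (G : SimpleGraph V) (T I : Finset V) : ℝ :=
  if Disjoint T I ∧ G.IsClique ((I ∪ T : Finset V) : Set V) then 1 else 0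

/-- The indicator that `P` and `Q` are disjoint and completely joined. -/
noncomputable def crossProd {V : Type*} (G : SimpleGraph V) (P Q : Finset V) : ℝ :=
  ∏ a ∈ P, ∏ b ∈ Q, adjInd G a b

open Classical in
theorem crossProd_eq {V : Type*} (G : SimpleGraph V) (P Q : Finset V) :
    crossProd G P Q = if ∀ a ∈ P, ∀ b ∈ Q, G.Adj a b then 1 else 0 := by
  unfold crossProd adjInd
  split_ifs with h
  · exact prod_eq_one fun a ha => prod_eq_one fun b hb => if_pos (h a ha b hb)
  · push Not at h
    obtain ⟨a, ha, b, hb, hab⟩ := h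
    exact prod_eq_zero ha (prod_eq_zero hb (if_neg hab))

theorem crossProd_sdiff_eq_zero {V : Type*} [DecidableEq V] (G : SimpleGraph V)
    {I J K : Finset V} (hI : K ⊆ I) (hJ : K ⊆ J) (h : K ≠ I ∩ J) :
    crossProd G (I \ K) (J \ K) = 0 := by
  classical
  rw [crossProd_eq, if_neg]
  intro hall
  refine h (subset_antisymm (subset_inter hI hJ) fun v hv => ?_)
  by_contra hvK
  obtain ⟨h1, h2⟩ := mem_inter.1 hv
  exact G.loopless.irrefl v (hall v (mem_sdiff.2 ⟨h1, hvK⟩) v (mem_sdiff.2 ⟨h2, hvK⟩))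

theorem isClique_union_iff {V : Type*} [DecidableEq V] (G : SimpleGraph V) (I J T : Finset V) :
    G.IsClique ((I ∪ J ∪ T : Finset V) : Set V) ↔
      G.IsClique ((I ∪ T : Finset V) : Set V) ∧ G.IsClique ((J ∪ T : Finset V) : Set V) ∧
      ∀ a ∈ I \ (I ∩ J), ∀ b ∈ J \ (I ∩ J), G.Adj a b := by
  simp only [SimpleGraph.isClique_iff, Set.Pairwise, coe_union, Set.mem_union, mem_coe,
    Finset.mem_sdiff, Finset.mem_inter]
  constructor
  · intro h
    refine ⟨fun a ha b hb => h ?_ ?_, fun a ha b hb => h ?_ ?_, fun a ha b hb => h ?_ ?_ ?_⟩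
    iterate 6 tauto
    rintro rfl
    tauto
  · rintro ⟨h1, h2, h3⟩ a ha b hb hab
    by_cases ha1 : a ∈ I ∨ a ∈ T
    · by_cases hb1 : b ∈ I ∨ b ∈ T
      · exact h1 ha1 hb1 hab
      · by_cases ha2 : a ∈ J ∨ a ∈ T
        · exact h2 ha2 (by tauto) hab
        · exact h3 a (by tauto) b (by tauto)
    · by_cases hb2 : b ∈ J ∨ b ∈ T
      · exact h2 (by tauto) hb2 hab
      · exact (h3 b (by tauto) a (by tauto)).symm

theorem sum_extInd_eq_degG {n : ℕ} (G : SimpleGraph (Fin n)) {r : ℕ} {I J : Finset (Fin n)}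
    (hI : I.card = r) (hJ : J.card = r) :
    ∑ T ∈ powersetCard (I ∩ J).card univ,
      extInd G T I * extInd G T J * crossProd G (I \ (I ∩ J)) (J \ (I ∩ J)) =
      degG G r (I ∪ J) := by
  classical
  have hcard := card_union_add_card_inter I J
  have h1 : ∀ T, extInd G T I * extInd G T J * crossProd G (I \ (I ∩ J)) (J \ (I ∩ J)) =
      if Disjoint T (I ∪ J) ∧ G.IsClique ((I ∪ J ∪ T : Finset (Fin n)) : Set (Fin n))
      then 1 else 0 := by
    intro T
    rw [crossProd_eq, extInd, extInd, ite_zero_mul_ite_zero, ite_zero_mul_ite_zero,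
      mul_one, mul_one]
    have hiff : ((Disjoint T I ∧ G.IsClique ((I ∪ T : Finset (Fin n)) : Set (Fin n))) ∧
        Disjoint T J ∧ G.IsClique ((J ∪ T : Finset (Fin n)) : Set (Fin n))) ∧
        (∀ a ∈ I \ (I ∩ J), ∀ b ∈ J \ (I ∩ J), G.Adj a b) ↔
        Disjoint T (I ∪ J) ∧ G.IsClique ((I ∪ J ∪ T : Finset (Fin n)) : Set (Fin n)) := by
      rw [isClique_union_iff, disjoint_union_right]
      tauto
    by_cases h : Disjoint T (I ∪ J) ∧ G.IsClique ((I ∪ J ∪ T : Finset (Fin n)) : Set (Fin n))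
    · rw [if_pos h]
      exact if_pos (hiff.2 h)
    · rw [if_neg h]
      exact if_neg (mt hiff.1 h)
  simp_rw [h1]
  rw [sum_boole, degG_eq_card, Nat.cast_inj]
  refine card_nbij' (fun T => I ∪ J ∪ T) (fun S => S \ (I ∪ J)) ?_ ?_ ?_ ?_
  · intro T hT
    simp only [coe_filter, mem_powersetCard, Set.mem_ofPred_eq, mem_univ, true_and] at hT ⊢
    refine ⟨subset_union_left, ?_, hT.2.2⟩
    rw [card_union_of_disjoint hT.2.1.symm]
    omega
  · intro S hS
    simp only [coe_filter, mem_powersetCard, Set.mem_ofPred_eq, mem_univ, true_and] at hS ⊢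
    refine ⟨⟨subset_univ _, ?_⟩, sdiff_disjoint, ?_⟩
    · rw [card_sdiff_of_subset hS.1]
      omega
    · rw [union_sdiff_of_subset hS.1]
      exact hS.2.2
  · intro T hT
    simp only [coe_filter, mem_powersetCard, Set.mem_ofPred_eq] at hT
    exact union_sdiff_cancel_left hT.2.1.symm
  · intro S hS
    simp only [coe_filter, Set.mem_ofPred_eq] at hS
    exact union_sdiff_of_subset hS.2.1

/-- The weight `C(k,u)/C(2r,u)`. -/
noncomputable def chooseRatio (r k u : ℕ) : ℝ := (k.choose u : ℝ) / ((2 * r).choose u : ℝ)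

/-- The contribution of a pair `(K, T)` to the quadratic form of `M_G`. -/
noncomputable def pairForm {n : ℕ} (G : SimpleGraph (Fin n)) (r : ℕ) (x : Finset (Fin n) → ℝ)
    (K T : Finset (Fin n)) : ℝ :=
  ∑ I ∈ (powersetCard r univ).filter (K ⊆ ·), ∑ J ∈ (powersetCard r univ).filter (K ⊆ ·),
    (x I * extInd G T I) * (x J * extInd G T J) * crossProd G (I \ K) (J \ K)

theorem quadForm_eq_sum_pairForm {n : ℕ} (G : SimpleGraph (Fin n)) (r k : ℕ)
    (x : Finset (Fin n) → ℝ) :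
    ∑ I ∈ powersetCard r univ, ∑ J ∈ powersetCard r univ,
      x I * x J * (degG G r (I ∪ J) * chooseRatio r k (I ∪ J).card) =
    ∑ K, chooseRatio r k (2 * r - K.card) * ∑ T ∈ powersetCard K.card univ, pairForm G r x K T := by
  have h1 : ∀ K : Finset (Fin n), chooseRatio r k (2 * r - K.card) *
      ∑ T ∈ powersetCard K.card univ, pairForm G r x K T =
      ∑ I ∈ powersetCard r univ, ∑ J ∈ powersetCard r univ, if K ⊆ I ∧ K ⊆ J then
        x I * x J * (chooseRatio r k (2 * r - K.card) * ∑ T ∈ powersetCard K.card univ,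
          extInd G T I * extInd G T J * crossProd G (I \ K) (J \ K)) else 0 := by
    intro K
    unfold pairForm
    simp_rw [sum_filter]
    rw [mul_sum]
    simp_rw [mul_sum]
    rw [sum_comm]
    refine sum_congr rfl fun I _ => ?_
    by_cases hI : K ⊆ I
    · simp only [hI, if_true, true_and, mul_sum]
      rw [sum_comm]
      refine sum_congr rfl fun J _ => ?_
      by_cases hJ : K ⊆ J
      · simp only [hJ, if_true]
        exact sum_congr rfl fun T _ => by ring
      · simp [hJ]
    · simp [hI]
  simp_rw [h1]
  conv_rhs => rw [sum_comm]
  refine sum_congr rfl fun I hI => ?_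
  conv_rhs => rw [sum_comm]
  refine sum_congr rfl fun J hJ => ?_
  have hI' := (mem_powersetCard.1 hI).2
  have hJ' := (mem_powersetCard.1 hJ).2
  have hcard := card_union_add_card_inter I J
  rw [sum_eq_single (I ∩ J)]
  · rw [if_pos ⟨inter_subset_left, inter_subset_right⟩, sum_extInd_eq_degG G hI' hJ',
      show 2 * r - (I ∩ J).card = (I ∪ J).card by omega]
    ring
  · intro K _ hK
    split_ifs with h
    · simp [crossProd_sdiff_eq_zero G h.1 h.2 hK]
    · rfl
  · simp

theorem neg_le_pairForm {n : ℕ} (hn : 0 < n) (G : SimpleGraph (Fin n)) {β : ℝ}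
    (hG : CentredNormLE G β) (hβ : 0 ≤ β) (r : ℕ) (x : Finset (Fin n) → ℝ)
    (K T : Finset (Fin n)) :
    -(((r - K.card : ℕ) : ℝ) ^ 2 * β * n ^ (r - K.card) *
      ∑ I ∈ (powersetCard r univ).filter (K ⊆ ·), (x I * extInd G T I) ^ 2) ≤
      n * pairForm G r x K T := by
  classical
  have : Nonempty (Fin n) := ⟨⟨0, hn⟩⟩
  have hex : ∀ S : Finset (Fin n), ∃ e : Fin (r - K.card) → Fin n, S.card = r - K.card →
      Function.Injective e ∧ univ.image e = S := by
    intro S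
    by_cases hS : S.card = r - K.card
    · refine ⟨S.orderEmbOfFin hS, fun _ => ⟨(S.orderEmbOfFin hS).injective, ?_⟩⟩
      exact image_orderEmbOfFin_univ S hS
    · exact ⟨fun _ => ⟨0, hn⟩, fun h => absurd h hS⟩
  choose e he using hex
  have hP : ∀ I ∈ (powersetCard r (univ : Finset (Fin n))).filter (K ⊆ ·),
      K ⊆ I ∧ (I \ K).card = r - K.card := by
    intro I hI
    obtain ⟨h1, h2⟩ := mem_filter.1 hI
    exact ⟨h2, by rw [card_sdiff_of_subset h2, (mem_powersetCard.1 h1).2]⟩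
  have h := neg_le_sum_prod_adjInd G hG hβ ((powersetCard r univ).filter (K ⊆ ·))
    (fun I => e (I \ K)) ?_ (fun I => x I * extInd G T I)
  · rw [Fintype.card_fin, Fintype.card_fin] at h
    refine h.trans (le_of_eq ?_)
    unfold pairForm
    congr 1
    refine sum_congr rfl fun I hI => sum_congr rfl fun J hJ => ?_
    obtain ⟨hi, hi'⟩ := he (I \ K) (hP I hI).2
    obtain ⟨hj, hj'⟩ := he (J \ K) (hP J hJ).2
    congr 1
    rw [crossProd, Fintype.prod_prod_type]
    nth_rewrite 2 [← hi']
    rw [prod_image hi.injOn]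
    refine prod_congr rfl fun a _ => ?_
    nth_rewrite 2 [← hj']
    rw [prod_image hj.injOn]
  · intro I hI J hJ hIJ
    have h1 := (he (I \ K) (hP I hI).2).2
    have h2 := (he (J \ K) (hP J hJ).2).2
    have h3 : I \ K = J \ K := by
      rw [← h1, ← h2]
      exact congrArg (fun f => univ.image f) hIJ
    rw [← union_sdiff_of_subset (hP I hI).1, ← union_sdiff_of_subset (hP J hJ).1, h3]

theorem choose_two_mul_sub_le {r k t : ℕ} (hk : 1 ≤ k) (ht : t ≤ r) :
    k.choose (2 * r - t) ≤ k.choose r * k ^ r := by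
  rcases lt_or_ge k (2 * r - t) with h | h
  · rw [Nat.choose_eq_zero_of_lt h]
    exact Nat.zero_le _
  · have h1 := Nat.choose_mul (n := k) (k := 2 * r - t) (s := r) (by omega)
    calc k.choose (2 * r - t) ≤ k.choose (2 * r - t) * (2 * r - t).choose r :=
          Nat.le_mul_of_pos_right _ (Nat.choose_pos (by omega))
      _ = k.choose r * (k - r).choose (2 * r - t - r) := h1
      _ ≤ k.choose r * k ^ r := by
          gcongr
          calc (k - r).choose (2 * r - t - r) ≤ (k - r) ^ (2 * r - t - r) := Nat.choose_le_pow _ _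
            _ ≤ k ^ (2 * r - t - r) := Nat.pow_le_pow_left (Nat.sub_le _ _) _
            _ ≤ k ^ r := Nat.pow_le_pow_right hk (by omega)

open Classical in
/-- The indicator that `I` is a clique. -/
noncomputable def cliqueInd {V : Type*} (G : SimpleGraph V) (I : Finset V) : ℝ :=
  if G.IsClique (I : Set V) then 1 else 0

theorem cliqueInd_nonneg {V : Type*} (G : SimpleGraph V) (I : Finset V) : 0 ≤ cliqueInd G I := by
  unfold cliqueInd
  split_ifs <;> simp

theorem extInd_sq_le {V : Type*} [DecidableEq V] (G : SimpleGraph V) (T I : Finset V) :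
    extInd G T I ^ 2 ≤ cliqueInd G I := by
  unfold extInd cliqueInd
  split_ifs with h1 h2 h2
  · simp
  · refine absurd (h1.2.subset ?_) h2
    intro v hv
    simp only [mem_coe] at hv
    simp [hv]
  · simp
  · simp

theorem chooseRatio_nonneg (r k u : ℕ) : 0 ≤ chooseRatio r k u := by
  unfold chooseRatio; positivity

theorem neg_le_sum_pairForm {n : ℕ} (hn : 0 < n) (G : SimpleGraph (Fin n)) {β : ℝ}
    (hG : CentredNormLE G β) (hβ : 0 ≤ β) {r k : ℕ} (hk : 1 ≤ k) (x : Finset (Fin n) → ℝ)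
    (K : Finset (Fin n)) (hK : K.card ≤ r) :
    -((r : ℝ) ^ 2 * (k.choose r * k ^ r) * β * n ^ r *
      ∑ I ∈ (powersetCard r univ).filter (K ⊆ ·), x I ^ 2 * cliqueInd G I) ≤
      n * (chooseRatio r k (2 * r - K.card) *
        ∑ T ∈ powersetCard K.card univ, pairForm G r x K T) := by
  set W := ∑ I ∈ (powersetCard r univ).filter (K ⊆ ·), x I ^ 2 * cliqueInd G I with hW
  have hW0 : 0 ≤ W := sum_nonneg fun I _ => mul_nonneg (sq_nonneg _) (cliqueInd_nonneg G I)
  have h1 : ∀ T ∈ powersetCard K.card (univ : Finset (Fin n)),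
      -((r : ℝ) ^ 2 * β * n ^ (r - K.card) * W) ≤ n * pairForm G r x K T := by
    intro T _
    refine le_trans (neg_le_neg ?_) (neg_le_pairForm hn G hG hβ r x K T)
    have hs : ((r - K.card : ℕ) : ℝ) ≤ r := by exact_mod_cast Nat.sub_le _ _
    gcongr
    rw [hW]
    refine sum_le_sum fun I _ => ?_
    rw [mul_pow]
    exact mul_le_mul_of_nonneg_left (extInd_sq_le G T I) (sq_nonneg _)
  have h2 := sum_le_sum h1
  rw [sum_const, nsmul_eq_mul, ← mul_sum, card_powersetCard, card_univ, Fintype.card_fin] at h2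
  have hR : chooseRatio r k (2 * r - K.card) ≤ k.choose r * k ^ r := by
    have hpos : (1 : ℝ) ≤ ((2 * r).choose (2 * r - K.card) : ℕ) := by
      exact_mod_cast Nat.choose_pos (Nat.sub_le _ _)
    refine (div_le_self (by positivity) hpos).trans ?_
    exact_mod_cast choose_two_mul_sub_le hk hK
  have hN : ((n.choose K.card : ℕ) : ℝ) * n ^ (r - K.card) ≤ n ^ r := by
    calc ((n.choose K.card : ℕ) : ℝ) * n ^ (r - K.card) ≤ n ^ K.card * n ^ (r - K.card) := by
          gcongr
          exact_mod_cast Nat.choose_le_pow _ _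
      _ = n ^ r := by rw [← pow_add]; congr 1; omega
  have hc := chooseRatio_nonneg r k (2 * r - K.card)
  calc -((r : ℝ) ^ 2 * (k.choose r * k ^ r) * β * n ^ r * W)
      = -((k.choose r * k ^ r) * (r ^ 2 * β * n ^ r * W)) := by ring
    _ ≤ -(chooseRatio r k (2 * r - K.card) *
          (r ^ 2 * β * (n.choose K.card * n ^ (r - K.card)) * W)) := by
        gcongr
    _ = chooseRatio r k (2 * r - K.card) *
          (n.choose K.card * -((r : ℝ) ^ 2 * β * n ^ (r - K.card) * W)) := by ring
    _ ≤ chooseRatio r k (2 * r - K.card) *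
          (n * ∑ T ∈ powersetCard K.card univ, pairForm G r x K T) := by gcongr
    _ = _ := by ring

theorem le_sum_pairForm_of_card_eq {n : ℕ} (G : SimpleGraph (Fin n)) {r : ℕ} {D : ℝ}
    (hD : ∀ I : Finset (Fin n), I.card = r → G.IsClique (I : Set (Fin n)) → D ≤ degG G r I)
    (x : Finset (Fin n) → ℝ) (K : Finset (Fin n)) (hK : K.card = r) :
    D * (x K ^ 2 * cliqueInd G K) ≤ ∑ T ∈ powersetCard K.card univ, pairForm G r x K T := by
  have hP : (powersetCard r (univ : Finset (Fin n))).filter (K ⊆ ·) = {K} := by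
    ext I
    simp only [mem_filter, mem_powersetCard, subset_univ, true_and, mem_singleton]
    constructor
    · rintro ⟨h1, h2⟩
      exact (eq_of_subset_of_card_le h2 (by omega)).symm
    · rintro rfl
      exact ⟨hK, subset_rfl⟩
  have h1 := sum_extInd_eq_degG G hK hK
  rw [inter_self, union_self] at h1
  have h2 : ∑ T ∈ powersetCard K.card univ, pairForm G r x K T = x K ^ 2 * degG G r K := by
    rw [← h1, mul_sum]
    refine sum_congr rfl fun T _ => ?_
    rw [pairForm, hP, sum_singleton, sum_singleton]
    ring
  rw [h2]
  unfold cliqueInd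
  split_ifs with h
  · have := mul_le_mul_of_nonneg_right (hD K hK h) (sq_nonneg (x K))
    linarith
  · rw [mul_zero, mul_zero]
    positivity

theorem sum_pairForm_eq_zero {n : ℕ} (G : SimpleGraph (Fin n)) {r : ℕ}
    (x : Finset (Fin n) → ℝ) (K : Finset (Fin n)) (hK : r < K.card) :
    ∑ T ∈ powersetCard K.card univ, pairForm G r x K T = 0 := by
  have hP : (powersetCard r (univ : Finset (Fin n))).filter (K ⊆ ·) = ∅ := by
    refine filter_eq_empty_iff.2 fun I hI h => ?_
    have := card_le_card h
    rw [(mem_powersetCard.1 hI).2] at this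
    omega
  refine sum_eq_zero fun T _ => ?_
  rw [pairForm, hP, sum_empty]

theorem quadForm_nonneg {n : ℕ} (hn : 0 < n) (G : SimpleGraph (Fin n)) {β D : ℝ}
    (hG : CentredNormLE G β) (hβ : 0 ≤ β) {r k : ℕ} (hk : 1 ≤ k)
    (hD : ∀ I : Finset (Fin n), I.card = r → G.IsClique (I : Set (Fin n)) → D ≤ degG G r I)
    (hmain : 2 ^ r * (r : ℝ) ^ 2 * k ^ r * β * n ^ r ≤ n * (D / (2 * r).choose r))
    (x : Finset (Fin n) → ℝ) :
    0 ≤ ∑ I ∈ powersetCard r univ, ∑ J ∈ powersetCard r univ,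
      x I * x J * (degG G r (I ∪ J) * chooseRatio r k (I ∪ J).card) := by
  classical
  have hn' : (0 : ℝ) < n := by exact_mod_cast hn
  rw [quadForm_eq_sum_pairForm]
  refine nonneg_of_mul_nonneg_right ?_ hn'
  set E : ℝ := (r : ℝ) ^ 2 * (k.choose r * k ^ r) * β * n ^ r with hE
  have hE0 : 0 ≤ E := by positivity
  set w : Finset (Fin n) → ℝ := fun I => x I ^ 2 * cliqueInd G I with hw
  have hw0 : ∀ I, 0 ≤ w I := fun I => mul_nonneg (sq_nonneg _) (cliqueInd_nonneg G I)
  have hterm : ∀ K : Finset (Fin n), (if K.card = r then n * (chooseRatio r k r * (D * w K)) else 0) -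
      E * ∑ I ∈ (powersetCard r univ).filter (K ⊆ ·), w I ≤
      n * (chooseRatio r k (2 * r - K.card) *
        ∑ T ∈ powersetCard K.card univ, pairForm G r x K T) := by
    intro K
    have hS : 0 ≤ E * ∑ I ∈ (powersetCard r univ).filter (K ⊆ ·), w I :=
      mul_nonneg hE0 (sum_nonneg fun I _ => hw0 I)
    rcases lt_trichotomy K.card r with h | h | h
    · rw [if_neg h.ne, zero_sub]
      exact neg_le_sum_pairForm hn G hG hβ hk x K h.le
    · rw [if_pos h]
      refine (sub_le_self _ hS).trans ?_
      rw [show 2 * r - K.card = r by omega]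
      have := le_sum_pairForm_of_card_eq G hD x K h
      have := chooseRatio_nonneg r k r
      gcongr
    · rw [if_neg h.ne', sum_pairForm_eq_zero G x K h, mul_zero, mul_zero]
      linarith
  rw [mul_sum]
  refine le_trans ?_ (sum_le_sum fun K _ => hterm K)
  rw [sum_sub_distrib, ← mul_sum]
  have hA : ∑ K : Finset (Fin n), (if K.card = r then n * (chooseRatio r k r * (D * w K)) else 0) =
      n * chooseRatio r k r * D * ∑ I ∈ powersetCard r univ, w I := by
    rw [← sum_filter, mul_sum]
    refine sum_congr ?_ fun K _ => by ring
    ext K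
    simp [mem_powersetCard]
  have hB : ∑ K : Finset (Fin n), ∑ I ∈ (powersetCard r univ).filter (K ⊆ ·), w I =
      2 ^ r * ∑ I ∈ powersetCard r univ, w I := by
    simp_rw [sum_filter]
    rw [sum_comm, mul_sum]
    refine sum_congr rfl fun I hI => ?_
    rw [← sum_filter, sum_const, nsmul_eq_mul]
    congr 1
    rw [← (mem_powersetCard.1 hI).2, show (univ.filter fun K : Finset (Fin n) => K ⊆ I) =
      I.powerset by ext; simp, card_powerset]
    push_cast
    rfl
  rw [hA, hB, sub_nonneg]
  have hC : E * 2 ^ r ≤ n * chooseRatio r k r * D := by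
    have := mul_le_mul_of_nonneg_left hmain (Nat.cast_nonneg (α := ℝ) (k.choose r))
    calc E * 2 ^ r = k.choose r * (2 ^ r * (r : ℝ) ^ 2 * k ^ r * β * n ^ r) := by rw [hE]; ring
      _ ≤ _ := this
      _ = _ := by unfold chooseRatio; ring
  rw [← mul_assoc]
  exact mul_le_mul_of_nonneg_right hC (sum_nonneg fun I _ => hw0 I)

theorem MG_posSemidef {n : ℕ} (hn : 0 < n) (G : SimpleGraph (Fin n)) {β D : ℝ}
    (hG : CentredNormLE G β) (hβ : 0 ≤ β) {r k : ℕ} (hk : 1 ≤ k)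
    (hD : ∀ I : Finset (Fin n), I.card = r → G.IsClique (I : Set (Fin n)) → D ≤ degG G r I)
    (hmain : 2 ^ r * (r : ℝ) ^ 2 * k ^ r * β * n ^ r ≤ n * (D / (2 * r).choose r)) :
    (MG G r k).PosSemidef := by
  classical
  refine Matrix.PosSemidef.of_dotProduct_mulVec_nonneg ?_ fun x => ?_
  · ext I J
    simp [MG, Matrix.conjTranspose_apply, union_comm]
  · have h := quadForm_nonneg hn G hG hβ hk hD hmain
      (fun I => if h : I.card = r then x ⟨I, h⟩ else 0)
    refine h.trans (le_of_eq ?_)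
    have hmem : ∀ I : Finset (Fin n), I ∈ powersetCard r univ ↔ I.card = r := by
      simp [mem_powersetCard]
    rw [sum_subtype _ hmem]
    simp only [dotProduct, Matrix.mulVec, mul_sum]
    refine sum_congr rfl fun I _ => ?_
    rw [sum_subtype _ hmem]
    refine sum_congr rfl fun J _ => ?_
    simp only [I.2, J.2, dif_pos, MG, chooseRatio, Pi.star_apply, star_trivial]
    ring

theorem card_filter_card_le (V : Type*) [Fintype V] (hV : 0 < Fintype.card V) (m : ℕ) :
    ((univ.filter fun F : Finset V => F.card ≤ m).card : ℝ) ≤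
      (m + 1) * (Fintype.card V : ℝ) ^ m := by
  classical
  have h1 : (univ.filter fun F : Finset V => F.card ≤ m) ⊆
      (range (m + 1)).biUnion fun j => powersetCard j univ := by
    intro F hF
    simp only [mem_filter, mem_univ, true_and] at hF
    simp only [mem_biUnion, mem_range, mem_powersetCard]
    exact ⟨F.card, by omega, subset_univ _, rfl⟩
  have h2 := (card_le_card h1).trans card_biUnion_le
  have h3 : ∑ j ∈ range (m + 1), (powersetCard j (univ : Finset V)).card ≤
      ∑ _j ∈ range (m + 1), Fintype.card V ^ m := by
    refine sum_le_sum fun j hj => ?_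
    rw [card_powersetCard, card_univ]
    exact (Nat.choose_le_pow _ _).trans
      (Nat.pow_le_pow_right hV (by have := mem_range.1 hj; omega))
  rw [sum_const, card_range, smul_eq_mul] at h3
  exact_mod_cast h2.trans h3

/-- All star sums over nonempty sets of size at most `m` are at least `-τ`. -/
def StarSumsGE {V : Type*} [Fintype V] [DecidableEq V] (G : SimpleGraph V) (m : ℕ) (τ : ℝ) :
    Prop :=
  ∀ F : Finset V, F.Nonempty → F.card ≤ m → -τ ≤ ∑ v ∈ univ \ F, ∏ u ∈ F, adjSign G u v

open Classical in
theorem card_not_starSumsGE {n : ℕ} (hn : 0 < n) (m : ℕ) {τ : ℝ} (hτ : 0 ≤ τ) :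
    ((univ.filter fun G : SimpleGraph (Fin n) => ¬ StarSumsGE G m τ).card : ℝ) ≤
      Fintype.card (SimpleGraph (Fin n)) *
        ((m + 1) * n ^ m * Real.exp (-(τ ^ 2 / (2 * n)))) := by
  have hV : 0 < Fintype.card (Fin n) := by simpa using hn
  have h1 : (univ.filter fun G : SimpleGraph (Fin n) => ¬ StarSumsGE G m τ) ⊆
      (univ.filter fun F : Finset (Fin n) => F.Nonempty ∧ F.card ≤ m).biUnion fun F =>
        univ.filter fun G : SimpleGraph (Fin n) =>
          ∑ v ∈ univ \ F, ∏ u ∈ F, adjSign G u v ≤ -τ := by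
    intro G hG
    have hG2 := (mem_filter.1 hG).2
    unfold StarSumsGE at hG2
    push Not at hG2
    obtain ⟨F, hF, hFm, hlt⟩ := hG2
    refine mem_biUnion.2 ⟨F, mem_filter.2 ⟨mem_univ _, hF, hFm⟩, mem_filter.2 ⟨mem_univ _, ?_⟩⟩
    convert hlt.le
  have h2 : ((univ.filter fun G : SimpleGraph (Fin n) => ¬ StarSumsGE G m τ).card : ℝ) ≤
      ∑ F ∈ (univ.filter fun F : Finset (Fin n) => F.Nonempty ∧ F.card ≤ m),
        ((univ.filter fun G : SimpleGraph (Fin n) =>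
          ∑ v ∈ univ \ F, ∏ u ∈ F, adjSign G u v ≤ -τ).card : ℝ) := by
    exact_mod_cast (card_le_card h1).trans card_biUnion_le
  have h3 : ∀ F : Finset (Fin n), F.Nonempty → ((univ.filter fun G : SimpleGraph (Fin n) =>
      ∑ v ∈ univ \ F, ∏ u ∈ F, adjSign G u v ≤ -τ).card : ℝ) ≤
      Fintype.card (SimpleGraph (Fin n)) * Real.exp (-(τ ^ 2 / (2 * n))) := by
    intro F hF
    have h := card_star_sum_le F hF hτ hV
    rw [Fintype.card_fin] at h
    exact h
  have h4 : (((univ.filter fun F : Finset (Fin n) => F.Nonempty ∧ F.card ≤ m)).card : ℝ) ≤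
      (m + 1) * n ^ m := by
    have := card_filter_card_le (Fin n) hV m
    rw [Fintype.card_fin] at this
    refine le_trans ?_ this
    refine Nat.cast_le.2 (card_le_card fun F hF => ?_)
    exact mem_filter.2 ⟨mem_univ _, (mem_filter.1 hF).2.2⟩
  calc _ ≤ _ := h2
    _ ≤ ∑ F ∈ (univ.filter fun F : Finset (Fin n) => F.Nonempty ∧ F.card ≤ m),
        (Fintype.card (SimpleGraph (Fin n)) : ℝ) * Real.exp (-(τ ^ 2 / (2 * n))) := by
      refine sum_le_sum fun F hF => ?_
      exact h3 F (mem_filter.1 hF).2.1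
    _ = (((univ.filter fun F : Finset (Fin n) => F.Nonempty ∧ F.card ≤ m)).card : ℝ) *
        (Fintype.card (SimpleGraph (Fin n)) * Real.exp (-(τ ^ 2 / (2 * n)))) := by
      rw [sum_const, nsmul_eq_mul]
    _ ≤ ((m + 1) * n ^ m) *
        (Fintype.card (SimpleGraph (Fin n)) * Real.exp (-(τ ^ 2 / (2 * n)))) := by gcongr
    _ = _ := by ring

theorem pow_mul_exp_neg_le {n : ℕ} (hn : 3 ≤ n) :
    ((2 * n + 1 : ℝ)) ^ (2 * n) * Real.exp (-((4 * √(n * Real.log n)) ^ 2 / 2)) ≤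
      Real.exp (-n) := by
  have hn3 : (3 : ℝ) ≤ n := by exact_mod_cast hn
  have hlog : 1 ≤ Real.log n := by
    rw [Real.le_log_iff_exp_le (by linarith)]
    have := Real.exp_one_lt_three
    linarith
  have h1 : ((2 * n + 1 : ℝ)) ^ (2 * n) ≤ Real.exp (4 * n * Real.log n) := by
    calc ((2 * n + 1 : ℝ)) ^ (2 * n) ≤ ((n : ℝ) ^ 2) ^ (2 * n) := by
          gcongr
          nlinarith
      _ = Real.exp (4 * n * Real.log n) := by
          rw [← pow_mul, show (4 * n * Real.log n : ℝ) = ((2 * (2 * n) : ℕ) : ℝ) * Real.log n by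
            push_cast; ring, Real.exp_nat_mul, Real.exp_log (by linarith)]
  have h2 : (4 * √(n * Real.log n)) ^ 2 / 2 = 8 * (n * Real.log n) := by
    rw [mul_pow, Real.sq_sqrt (by positivity)]
    ring
  rw [h2]
  calc _ ≤ Real.exp (4 * n * Real.log n) * Real.exp (-(8 * (n * Real.log n))) := by gcongr
    _ = Real.exp (-(4 * (n * Real.log n))) := by rw [← Real.exp_add]; congr 1; ring
    _ ≤ _ := by
      rw [Real.exp_le_exp]
      nlinarith

/-- The typical properties of `G(n,1/2)` force `M_G` to be positive semidefinite once `n` is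
large in terms of `r`. -/
theorem MG_posSemidef_of_typical {n r k : ℕ} (hr : 1 ≤ r) (hk : 1 ≤ k) (hn3 : 3 ≤ n)
    (hn : 8 * r * (2 : ℝ) ^ (2 * r) ≤ n)
    (hlog : (6 * 2 ^ r * r ^ 2 * (4 * 2 ^ (2 * r) * r) ^ r * (2 * r).choose r : ℝ) ≤
      √(Real.log n))
    (G : SimpleGraph (Fin n))
    (h1 : CentredNormLE G (4 * √(n * Real.log n) + 1 / 2 + √n))
    (h2 : StarSumsGE G (2 * r) (n / (4 * 2 ^ (2 * r))))
    (hkn : (k : ℝ) ^ r ≤ √n / Real.log n) : (MG G r k).PosSemidef := by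
  have hn3' : (3 : ℝ) ≤ n := by exact_mod_cast hn3
  have hr' : (1 : ℝ) ≤ r := by exact_mod_cast hr
  have hL : 1 ≤ Real.log n := by
    rw [Real.le_log_iff_exp_le (by linarith)]
    have := Real.exp_one_lt_three
    linarith
  set Q : ℝ := 2 ^ (2 * r) with hQ
  have hQ0 : 0 < Q := by positivity
  have hD : ∀ I : Finset (Fin n), I.card = r → G.IsClique (I : Set (Fin n)) →
      (n / (4 * Q * r)) ^ r ≤ (degG G r I : ℝ) := by
    intro I hI hc
    have hm : ∀ U : Finset (Fin n), U.card ≤ 2 * r → (n / (2 * Q) : ℝ) ≤ (commonNbrs G U).card := by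
      intro U hU
      have h := card_commonNbrs_ge G (by positivity) h2 U hU
      rw [Fintype.card_fin, ← hQ] at h
      rw [div_le_iff₀ (by positivity)]
      have h3 : Q * (n / (4 * Q) + (2 * r : ℕ)) = n / 4 + 2 * r * Q := by
        push_cast
        field_simp
      rw [h3] at h
      linarith
    have h := pow_le_degG G hr (by positivity) hm r I (by omega) hc
    convert h using 2
    field_simp
    norm_num
  refine MG_posSemidef (by omega) G h1 (by positivity) hk hD ?_
  set L := Real.log n with hLdef
  set s := √L with hs
  have hs1 : 1 ≤ s := by rw [hs]; exact Real.one_le_sqrt.2 hL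
  have hsL : s * s = L := Real.mul_self_sqrt (by linarith)
  have hnn : √(n : ℝ) * √n = n := Real.mul_self_sqrt (by positivity)
  have hsn1 : 1 ≤ √(n : ℝ) := Real.one_le_sqrt.2 (by linarith)
  have hβ : 4 * √(n * L) + 1 / 2 + √n ≤ 6 * (√n * s) := by
    rw [Real.sqrt_mul (by positivity)]
    nlinarith
  have hC : (0 : ℝ) < (2 * r).choose r := by exact_mod_cast Nat.choose_pos (by omega)
  have hkey : (k : ℝ) ^ r * (4 * √(n * L) + 1 / 2 + √n) ≤ 6 * n / s := by
    calc (k : ℝ) ^ r * (4 * √(n * L) + 1 / 2 + √n) ≤ √n / L * (6 * (√n * s)) := by gcongr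
      _ = 6 * (√n * √n) * s / (s * s) := by rw [hsL]; ring
      _ = 6 * n / s := by
        rw [hnn]
        field_simp
  calc 2 ^ r * (r : ℝ) ^ 2 * k ^ r * (4 * √(n * L) + 1 / 2 + √n) * n ^ r
      = 2 ^ r * (r : ℝ) ^ 2 * n ^ r * (k ^ r * (4 * √(n * L) + 1 / 2 + √n)) := by ring
    _ ≤ 2 ^ r * (r : ℝ) ^ 2 * n ^ r * (6 * n / s) := by gcongr
    _ = (6 * 2 ^ r * r ^ 2) * n ^ r * n / s := by ring
    _ ≤ n * ((n / (4 * Q * r)) ^ r / (2 * r).choose r) := by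
      rw [div_le_iff₀ (by linarith), div_pow, div_div, mul_div_assoc', div_mul_eq_mul_div,
        le_div_iff₀ (by positivity)]
      calc (6 * 2 ^ r * r ^ 2) * n ^ r * n * ((4 * Q * r) ^ r * (2 * r).choose r)
          = (n * n ^ r) * (6 * 2 ^ r * r ^ 2 * (4 * Q * r) ^ r * (2 * r).choose r : ℝ) := by ring
        _ ≤ (n * n ^ r) * s := by gcongr

theorem pow_le_of_le_rpow_inv {r k n : ℕ} (hr : 1 ≤ r)
    (h : (k : ℝ) ≤ (2 : ℝ) ^ (-(1 * r : ℝ)) * (√n / Real.log n) ^ ((1 : ℝ) / r)) :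
    (k : ℝ) ^ r ≤ √n / Real.log n := by
  have hlog : 0 ≤ Real.log n := Real.log_natCast_nonneg n
  have hX : 0 ≤ √(n : ℝ) / Real.log n := by positivity
  have h1 : (k : ℝ) ≤ (√n / Real.log n) ^ ((1 : ℝ) / r) := by
    refine h.trans (mul_le_of_le_one_left (by positivity) ?_)
    exact Real.rpow_le_one_of_one_le_of_nonpos one_le_two (by simp)
  calc (k : ℝ) ^ r ≤ ((√n / Real.log n) ^ ((1 : ℝ) / r)) ^ r := by gcongr
    _ = √n / Real.log n := by
      rw [one_div, Real.rpow_inv_natCast_pow hX (by omega)]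

theorem one_sub_le_card_div {Ω : Type*} [Fintype Ω] [Nonempty Ω] {P A B : Ω → Prop}
    (h : ∀ ω, A ω → B ω → P ω) {a b : ℝ}
    (ha : (Nat.card {ω // ¬ A ω} : ℝ) ≤ Fintype.card Ω * a)
    (hb : (Nat.card {ω // ¬ B ω} : ℝ) ≤ Fintype.card Ω * b) :
    1 - (a + b) ≤ (Nat.card {ω // P ω} : ℝ) / Nat.card Ω := by
  classical
  have hΩ : (0 : ℝ) < Fintype.card Ω := by exact_mod_cast Fintype.card_pos
  rw [Nat.card_eq_fintype_card, Fintype.card_subtype] at ha hb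
  rw [Nat.card_eq_fintype_card, Nat.card_eq_fintype_card, Fintype.card_subtype,
    le_div_iff₀ hΩ]
  have h1 : (univ : Finset Ω) ⊆ univ.filter P ∪ (univ.filter (fun ω => ¬ A ω) ∪
      univ.filter (fun ω => ¬ B ω)) := by
    intro ω _
    simp only [mem_union, mem_filter, mem_univ, true_and]
    have := h ω
    tauto
  have h2 : Fintype.card Ω ≤ (univ.filter P).card + ((univ.filter (fun ω => ¬ A ω)).card +
      (univ.filter (fun ω => ¬ B ω)).card) :=
    (card_le_card h1).trans ((card_union_le _ _).trans
      (Nat.add_le_add_left (card_union_le _ _) _))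
  have h3 : (Fintype.card Ω : ℝ) ≤ (univ.filter P).card + ((univ.filter (fun ω => ¬ A ω)).card +
      (univ.filter (fun ω => ¬ B ω)).card) := by exact_mod_cast h2
  linarith

theorem tendsto_natCast_pow_mul_exp_neg {a : ℝ} (ha : 0 < a) (m : ℕ) :
    Tendsto (fun n : ℕ => (n : ℝ) ^ m * Real.exp (-(a * n))) atTop (nhds 0) := by
  have h := ((Real.tendsto_pow_mul_exp_neg_atTop_nhds_zero m).comp
    (tendsto_natCast_atTop_atTop.const_mul_atTop ha)).const_mul ((a ^ m)⁻¹)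
  rw [mul_zero] at h
  refine h.congr fun n => ?_
  simp only [Function.comp_apply, mul_pow]
  field_simp

/-- There is a constant `c > 0` such that for every fixed integer
`r ≥ 1`, with probability tending to `1` as `n → ∞` over `G ← G(n,1/2)` (uniform over
all graphs on `[n]`), the matrix `M_G` is positive semidefinite for every positive
integer `k ≤ 2^{−cr}·(√n/log n)^{1/r}`. -/
theorem MG_posSemidef_whp :
    ∃ c : ℝ, 0 < c ∧ ∀ r : ℕ, 1 ≤ r →
      Tendsto (fun n : ℕ =>
        (Nat.card {G : SimpleGraph (Fin n) //
          ∀ k : ℕ, 1 ≤ k →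
            (k : ℝ) ≤ (2 : ℝ) ^ (-(c * r)) * (Real.sqrt n / Real.log n) ^ ((1:ℝ)/r) →
            (MG G r k).PosSemidef} : ℝ)
          / (Nat.card (SimpleGraph (Fin n)) : ℝ))
        atTop (nhds 1) := by
  refine ⟨1, one_pos, fun r hr => ?_⟩
  classical
  set a : ℝ := (1 / (4 * 2 ^ (2 * r))) ^ 2 / 2 with ha
  have ha0 : 0 < a := by positivity
  have hlim : Tendsto (fun n : ℕ => 1 - (Real.exp (-n) +
      ((2 * r : ℕ) + 1) * ((n : ℝ) ^ (2 * r) * Real.exp (-(a * n))))) atTop (nhds 1) := by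
    have h1 := tendsto_natCast_pow_mul_exp_neg one_pos 0
    have h2 := (tendsto_natCast_pow_mul_exp_neg ha0 (2 * r)).const_mul (((2 * r : ℕ) : ℝ) + 1)
    simpa using (h1.add h2).const_sub 1
  refine tendsto_of_tendsto_of_tendsto_of_le_of_le' hlim tendsto_const_nhds ?_ ?_
  · have e1 := tendsto_natCast_atTop_atTop (R := ℝ).eventually_ge_atTop
      (8 * r * (2 : ℝ) ^ (2 * r))
    have e2 := (Real.tendsto_sqrt_atTop.comp (Real.tendsto_log_atTop.comp
      (tendsto_natCast_atTop_atTop (R := ℝ)))).eventually_ge_atTop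
      (6 * 2 ^ r * r ^ 2 * (4 * 2 ^ (2 * r) * r) ^ r * (2 * r).choose r : ℝ)
    filter_upwards [e1, e2, eventually_ge_atTop 3] with n hn1 hn2 hn3
    have hn0 : 0 < n := by omega
    have hn0' : (0 : ℝ) < n := by exact_mod_cast hn0
    refine one_sub_le_card_div (A := fun G => CentredNormLE G (4 * √(n * Real.log n) + 1 / 2 + √n))
      (B := fun G => StarSumsGE G (2 * r) (n / (4 * 2 ^ (2 * r)))) ?_ ?_ ?_
    · intro G hA hB k hk hkn
      exact MG_posSemidef_of_typical hr hk hn3 hn1 hn2 G hA hB (pow_le_of_le_rpow_inv hr hkn)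
    · rw [Nat.card_eq_fintype_card, Fintype.card_subtype]
      refine le_trans ?_ (mul_le_mul_of_nonneg_left (pow_mul_exp_neg_le hn3) (Nat.cast_nonneg _))
      exact card_not_centredNormLE hn0 (by positivity)
    · rw [Nat.card_eq_fintype_card, Fintype.card_subtype]
      refine (card_not_starSumsGE hn0 (2 * r) (by positivity)).trans (le_of_eq ?_)
      have : ((n : ℝ) / (4 * 2 ^ (2 * r))) ^ 2 / (2 * n) = a * n := by
        rw [ha]
        field_simp
      rw [this, mul_assoc]
  · filter_upwards with n
    refine div_le_one_of_le₀ ?_ (Nat.cast_nonneg _)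
    exact_mod_cast Nat.card_le_card_of_injective _ Subtype.val_injective
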